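/- arXiv:2603.12197 — 2 statements merged into one kernel-verified Lean document; each statement's English description precedes it below -/
import Mathlib

section
/- Define on 𝒩 the multiplication u · v := θ(uv). Then (𝒩, ·, empty word) is a monoid, and the map h : G(μ) → 𝒩 given by h([w]) := θ(w) is well-defined and is a monoid isomorphism. -/
/-- Letters: generators from `𝒳 = Fin n` and scalar letters `J k`, `k ∈ ℤ_d`. -/
inductive Letter (n d : ℕ) : Type where
  | gen : Fin n → Letter n d
  | J   : ZMod d → Letter n d

/-- The oriented rewrite rules of the system `→_G`. -/
inductive GRule (n d : ℕ) (μ : Fin n → Fin n → ZMod d) :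
    List (Letter n d) → List (Letter n d) → Prop where
  | mu {x y : Fin n} : y < x →
      GRule n d μ [Letter.gen x, Letter.gen y]
        [Letter.J (μ x y), Letter.gen y, Letter.gen x]
  | J0 : GRule n d μ [Letter.J 0] []
  | Jadd (k k' : ZMod d) : GRule n d μ [Letter.J k, Letter.J k'] [Letter.J (k + k')]
  | xJ (x : Fin n) (k : ZMod d) :
      GRule n d μ [Letter.gen x, Letter.J k] [Letter.J k, Letter.gen x]
  | pow (x : Fin n) : GRule n d μ (List.replicate d (Letter.gen x)) []

/-- One rewrite step: closure of the rules under contexts. -/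
def GStep (n d : ℕ) (μ : Fin n → Fin n → ZMod d) (s t : List (Letter n d)) : Prop :=
  ∃ u v w₁ w₂, GRule n d μ u v ∧ s = w₁ ++ u ++ w₂ ∧ t = w₁ ++ v ++ w₂

/-- The (unoriented) relations R_G. -/
inductive RelG (n d : ℕ) (μ : Fin n → Fin n → ZMod d) :
    List (Letter n d) → List (Letter n d) → Prop where
  | mu (x y : Fin n) :
      RelG n d μ [Letter.gen x, Letter.gen y]
        [Letter.J (μ x y), Letter.gen y, Letter.gen x]
  | J0 : RelG n d μ [Letter.J 0] []
  | Jadd (k k' : ZMod d) : RelG n d μ [Letter.J k, Letter.J k'] [Letter.J (k + k')]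
  | Jx (k : ZMod d) (x : Fin n) :
      RelG n d μ [Letter.J k, Letter.gen x] [Letter.gen x, Letter.J k]
  | pow (x : Fin n) : RelG n d μ (List.replicate d (Letter.gen x)) []

/-- `≐`: the smallest monoid congruence on the free monoid containing the relations R_G. -/
def GCon (n d : ℕ) (μ : Fin n → Fin n → ZMod d) : Con (FreeMonoid (Letter n d)) :=
  conGen (fun a b => RelG n d μ (FreeMonoid.toList a) (FreeMonoid.toList b))

/-- The elements of `𝒩`: `J_k x₁^{k₁} ⋯ x_n^{k_n}` with `0 ≤ kᵢ < d`
(identifying `J_0` with the empty word). -/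
def NFword (n d : ℕ) (k : ZMod d) (e : Fin n → Fin d) : List (Letter n d) :=
  (if k = 0 then [] else [Letter.J k]) ++
    (List.finRange n).flatMap (fun i => List.replicate (e i : ℕ) (Letter.gen i))

open Matrix in
/-- The central extension of `(ℤ_d)ⁿ` by `ℤ_d` along the bilinear cocycle with matrix `T`. -/
@[ext]
structure TwistedMonoid (n d : ℕ) (T : Matrix (Fin n) (Fin n) (ZMod d)) where
  scalar : ZMod d
  vec : Fin n → ZMod d

namespace TwistedMonoid

open Matrix

variable {n d : ℕ} {T : Matrix (Fin n) (Fin n) (ZMod d)}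

instance : Mul (TwistedMonoid n d T) :=
  ⟨fun a b => ⟨a.scalar + b.scalar + a.vec ⬝ᵥ (T *ᵥ b.vec), a.vec + b.vec⟩⟩

instance : One (TwistedMonoid n d T) := ⟨⟨0, 0⟩⟩

@[simp] theorem mul_scalar (a b : TwistedMonoid n d T) :
    (a * b).scalar = a.scalar + b.scalar + a.vec ⬝ᵥ (T *ᵥ b.vec) := rfl

@[simp] theorem mul_vec (a b : TwistedMonoid n d T) : (a * b).vec = a.vec + b.vec := rfl

@[simp] theorem one_scalar : (1 : TwistedMonoid n d T).scalar = 0 := rfl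

@[simp] theorem one_vec : (1 : TwistedMonoid n d T).vec = 0 := rfl

instance : Monoid (TwistedMonoid n d T) where
  mul_assoc a b c := by
    ext1
    · simp only [mul_scalar, mul_vec, add_dotProduct, mulVec_add, dotProduct_add]
      ring
    · exact add_assoc _ _ _
  one_mul a := by ext1 <;> simp
  mul_one a := by ext1 <;> simp

end TwistedMonoid

/-- The strictly lower triangular part of a commutator matrix. -/
def lowerTwist {n d : ℕ} (μ : Fin n → Fin n → ZMod d) : Matrix (Fin n) (Fin n) (ZMod d) :=
  Matrix.of fun x y => if y < x then μ x y else 0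

theorem lowerTwist_apply {n d : ℕ} (μ : Fin n → Fin n → ZMod d) (x y : Fin n) :
    lowerTwist μ x y = if y < x then μ x y else 0 := rfl

/-- The value of a letter in the twisted monoid. -/
def Letter.value {n d : ℕ} (μ : Fin n → Fin n → ZMod d) :
    Letter n d → TwistedMonoid n d (lowerTwist μ)
  | .gen x => ⟨0, Pi.single x 1⟩
  | .J k => ⟨k, 0⟩

/-- Evaluation of words in the twisted monoid. -/
def evalWord {n d : ℕ} (μ : Fin n → Fin n → ZMod d) (w : List (Letter n d)) :
    TwistedMonoid n d (lowerTwist μ) :=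
  (w.map (Letter.value μ)).prod

/-- The sorted list over `Fin n` in which `i` occurs `e i` times. -/
def sortedWord {n : ℕ} (e : Fin n → ℕ) : List (Fin n) :=
  (List.finRange n).flatMap fun i => List.replicate (e i) i

theorem count_sortedWord {n : ℕ} (e : Fin n → ℕ) (x : Fin n) :
    (sortedWord e).count x = e x := by
  rw [sortedWord, List.count_flatMap, ← List.ofFn_eq_map, List.sum_ofFn,
    Finset.sum_eq_single x]
  · simp
  · intro i _ hi
    simp [List.count_replicate, hi]
  · simp

theorem pairwise_sortedWord {n : ℕ} (e : Fin n → ℕ) : (sortedWord e).Pairwise (· ≤ ·) := by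
  rw [sortedWord, List.pairwise_flatMap]
  refine ⟨fun i _ => List.pairwise_replicate.2 (Or.inr le_rfl), ?_⟩
  refine (List.pairwise_lt_finRange n).imp ?_
  intro i j hij x hx y hy
  rw [List.eq_of_mem_replicate hx, List.eq_of_mem_replicate hy]
  exact hij.le

theorem eq_sortedWord_count {n : ℕ} {l : List (Fin n)} (hl : l.Pairwise (· ≤ ·)) :
    l = sortedWord fun i => l.count i := by
  refine List.Perm.eq_of_pairwise' hl (pairwise_sortedWord _) ?_
  rw [List.perm_iff_count]
  intro x
  rw [count_sortedWord]

theorem NFword_eq {n d : ℕ} (k : ZMod d) (e : Fin n → Fin d) :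
    NFword n d k e =
      (if k = 0 then [] else [Letter.J k]) ++ (sortedWord fun i => (e i : ℕ)).map Letter.gen := by
  simp [NFword, sortedWord, List.map_flatMap]

section Evaluation

variable {n d : ℕ} {μ : Fin n → Fin n → ZMod d}

theorem evalWord_append (u v : List (Letter n d)) :
    evalWord μ (u ++ v) = evalWord μ u * evalWord μ v := by
  simp [evalWord]

theorem evalWord_map_gen {l : List (Fin n)} (hl : l.Pairwise (· ≤ ·)) :
    evalWord μ (l.map Letter.gen) = ⟨0, fun y => (l.count y : ZMod d)⟩ := by
  induction l with
  | nil => ext1 <;> simp [evalWord]; rfl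
  | cons x l ih =>
    rw [List.pairwise_cons] at hl
    have h : evalWord μ ((x :: l).map Letter.gen) =
        Letter.value μ (.gen x) * evalWord μ (l.map Letter.gen) := by simp [evalWord]
    rw [h, ih hl.2]
    ext1
    · simp only [Letter.value, TwistedMonoid.mul_scalar, add_zero, zero_add,
        single_one_dotProduct]
      rw [Matrix.mulVec]
      refine Finset.sum_eq_zero fun y _ => ?_
      by_cases hy : y < x
      · have : y ∉ l := fun hmem => absurd (hl.1 y hmem) (not_le.2 hy)
        simp [List.count_eq_zero_of_not_mem this]
      · simp [lowerTwist_apply, hy]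
    · ext y
      by_cases hy : y = x
      · subst hy; simp [Letter.value, add_comm]
      · simp [Letter.value, hy, Ne.symm hy]

theorem evalWord_NFword (k : ZMod d) (e : Fin n → Fin d) :
    evalWord μ (NFword n d k e) = ⟨k, fun y => ((e y : ℕ) : ZMod d)⟩ := by
  rw [NFword_eq, evalWord_append, evalWord_map_gen (pairwise_sortedWord _)]
  simp only [count_sortedWord]
  by_cases hk : k = 0
  · ext1 <;> simp [evalWord, hk]
  · ext1 <;> simp [evalWord, hk, Letter.value]

theorem NFword_eq_of_evalWord_eq {k k' : ZMod d} {e e' : Fin n → Fin d}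
    (h : evalWord μ (NFword n d k e) = evalWord μ (NFword n d k' e')) :
    NFword n d k e = NFword n d k' e' := by
  simp only [evalWord_NFword, TwistedMonoid.mk.injEq] at h
  obtain ⟨rfl, he⟩ := h
  congr 1
  ext i
  have hi := congrArg ZMod.val (congrFun he i)
  rwa [ZMod.val_natCast_of_lt (e i).isLt, ZMod.val_natCast_of_lt (e' i).isLt] at hi

theorem evalWord_eq_of_RelG (hskew : ∀ x y, μ x y = - μ y x) (hdiag : ∀ x, μ x x = 0)
    {u v : List (Letter n d)} (h : RelG n d μ u v) : evalWord μ u = evalWord μ v := by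
  induction h with
  | mu x y =>
    ext1
    · simp only [evalWord, Letter.value, List.map_cons, List.map_nil, List.prod_cons,
        List.prod_nil, mul_one, TwistedMonoid.mul_scalar, TwistedMonoid.mul_vec,
        single_one_dotProduct, Matrix.mulVec_single_one, zero_dotProduct, Matrix.col_apply,
        lowerTwist_apply]
      rcases lt_trichotomy x y with h | rfl | h
      · simp [h, h.not_gt, hskew x y]
      · simp [hdiag]
      · simp [h, h.not_gt]
    · simp [evalWord, Letter.value, add_comm]
  | J0 => ext1 <;> simp [evalWord, Letter.value]
  | Jadd k k' => ext1 <;> simp [evalWord, Letter.value]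
  | Jx k x => ext1 <;> simp [evalWord, Letter.value]
  | pow x =>
    rw [← List.map_replicate,
      evalWord_map_gen (List.pairwise_replicate.2 (Or.inr le_rfl))]
    ext1
    · rfl
    · ext y
      by_cases hy : x = y <;> simp [evalWord, List.count_replicate, hy]

theorem evalWord_eq_of_GCon (hskew : ∀ x y, μ x y = - μ y x) (hdiag : ∀ x, μ x x = 0)
    {u v : List (Letter n d)} (h : GCon n d μ (FreeMonoid.ofList u) (FreeMonoid.ofList v)) :
    evalWord μ u = evalWord μ v := by
  have hle : GCon n d μ ≤ Con.ker (FreeMonoid.lift (Letter.value μ)) :=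
    Con.conGen_le.2 fun a b hab => by
      simpa [Con.ker_rel, FreeMonoid.lift_apply, evalWord]
        using evalWord_eq_of_RelG hskew hdiag hab
  simpa [Con.ker_rel, FreeMonoid.lift_apply, evalWord] using hle h

end Evaluation

section Rewriting

variable {n d : ℕ} {μ : Fin n → Fin n → ZMod d}

theorem GCon_of_GRule {u v : List (Letter n d)} (h : GRule n d μ u v) :
    GCon n d μ (FreeMonoid.ofList u) (FreeMonoid.ofList v) := by
  cases h with
  | mu _ => exact ConGen.Rel.of _ _ (RelG.mu _ _)
  | J0 => exact ConGen.Rel.of _ _ RelG.J0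
  | Jadd k k' => exact ConGen.Rel.of _ _ (RelG.Jadd k k')
  | xJ x k => exact (GCon n d μ).symm (ConGen.Rel.of _ _ (RelG.Jx k x))
  | pow x => exact ConGen.Rel.of _ _ (RelG.pow x)

theorem GCon_of_reflTransGen_GStep {s t : List (Letter n d)}
    (h : Relation.ReflTransGen (GStep n d μ) s t) :
    GCon n d μ (FreeMonoid.ofList s) (FreeMonoid.ofList t) := by
  induction h with
  | refl => exact (GCon n d μ).refl _
  | tail _ hstep ih =>
    obtain ⟨u, v, w₁, w₂, hr, rfl, rfl⟩ := hstep
    exact (GCon n d μ).trans ih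
      ((GCon n d μ).mul ((GCon n d μ).mul ((GCon n d μ).refl (FreeMonoid.ofList w₁))
        (GCon_of_GRule hr)) ((GCon n d μ).refl (FreeMonoid.ofList w₂)))

theorem GStep.append_left {s t : List (Letter n d)} (w : List (Letter n d))
    (h : GStep n d μ s t) : GStep n d μ (w ++ s) (w ++ t) := by
  obtain ⟨u, v, w₁, w₂, hr, rfl, rfl⟩ := h
  exact ⟨u, v, w ++ w₁, w₂, hr, by simp, by simp⟩

theorem GRule.step {u v : List (Letter n d)} (h : GRule n d μ u v) (w : List (Letter n d)) :
    GStep n d μ (u ++ w) (v ++ w) :=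
  ⟨u, v, [], w, h, rfl, rfl⟩

theorem exists_map_gen_of_irreducible {w : List (Letter n d)}
    (hw : ¬ ∃ t, GStep n d μ w t) :
    ∃ (k : ZMod d) (l : List (Fin n)), l.Pairwise (· ≤ ·) ∧
      w = (if k = 0 then [] else [Letter.J k]) ++ l.map Letter.gen := by
  induction w with
  | nil => exact ⟨0, [], List.Pairwise.nil, by simp⟩
  | cons a w ih =>
    obtain ⟨k, l, hl, rfl⟩ := ih fun ⟨t, ht⟩ => hw ⟨_, ht.append_left [a]⟩
    have hk : k = 0 := by
      by_contra hk
      refine hw ?_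
      rw [if_neg hk]
      cases a with
      | gen x => exact ⟨_, (GRule.xJ x k).step (l.map Letter.gen)⟩
      | J j => exact ⟨_, (GRule.Jadd j k).step (l.map Letter.gen)⟩
    subst hk
    cases a with
    | J j =>
      have hj : j ≠ 0 := by
        rintro rfl
        exact hw ⟨_, GRule.J0.step _⟩
      exact ⟨j, l, hl, by simp [hj]⟩
    | gen x =>
      refine ⟨0, x :: l, ?_, by simp⟩
      cases l with
      | nil => exact List.pairwise_singleton _ _
      | cons y l =>
        have hxy : x ≤ y := by
          by_contra hlt
          refine hw ?_
          rw [if_pos rfl]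
          exact ⟨_, (GRule.mu (not_le.1 hlt)).step (l.map Letter.gen)⟩
        refine List.pairwise_cons.2 ⟨fun z hz => ?_, hl⟩
        rcases List.mem_cons.1 hz with rfl | hz
        · exact hxy
        · exact hxy.trans ((List.pairwise_cons.1 hl).1 z hz)

theorem exists_NFword_of_irreducible {w : List (Letter n d)}
    (hw : ¬ ∃ t, GStep n d μ w t) : ∃ k e, w = NFword n d k e := by
  obtain ⟨k, l, hl, rfl⟩ := exists_map_gen_of_irreducible hw
  have hcount : ∀ x, l.count x < d := by
    intro x
    by_contra hx
    obtain ⟨m, hm⟩ := Nat.exists_eq_add_of_le (not_lt.1 hx)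
    obtain ⟨s, t, hst⟩ := List.append_of_mem (List.mem_finRange x)
    refine hw ⟨_, List.replicate d (Letter.gen x), [],
      (if k = 0 then [] else [Letter.J k]) ++
        (s.flatMap fun i => List.replicate (l.count i) i).map Letter.gen,
      List.replicate m (Letter.gen x) ++
        (t.flatMap fun i => List.replicate (l.count i) i).map Letter.gen,
      GRule.pow x, ?_, rfl⟩
    conv_lhs => rw [eq_sortedWord_count hl, sortedWord, hst]
    simp [hm, List.replicate_add, -List.replicate_append_replicate]
  refine ⟨k, fun i => ⟨l.count i, hcount i⟩, ?_⟩
  rw [NFword_eq, ← eq_sortedWord_count hl]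

end Rewriting

theorem stmt2 (n d : ℕ) (hd : 2 ≤ d) (μ : Fin n → Fin n → ZMod d)
    (hskew : ∀ x y, μ x y = - μ y x) (hdiag : ∀ x, μ x x = 0)
    (θ : List (Letter n d) → List (Letter n d))
    (hθ : ∀ s, Relation.ReflTransGen (GStep n d μ) s (θ s) ∧ ¬ ∃ t, GStep n d μ (θ s) t) :
    -- 𝒩 is closed under the product u · v := θ(uv)
    (∀ u v : List (Letter n d), ∃ k e, θ (u ++ v) = NFword n d k e) ∧
    -- the product is associative
    (∀ u v w : List (Letter n d), θ (θ (u ++ v) ++ w) = θ (u ++ θ (v ++ w))) ∧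
    -- elements of 𝒩 are θ-fixed, so the empty word is a two-sided unit for ·
    (∀ k e, θ (NFword n d k e) = NFword n d k e) ∧
    -- h : G(μ) → 𝒩, h([w]) := θ(w), is well-defined and a monoid isomorphism
    (∃ h : (GCon n d μ).Quotient ≃ {w : List (Letter n d) // ∃ k e, w = NFword n d k e},
      (∀ w : List (Letter n d), (h (Con.mk' (GCon n d μ) (FreeMonoid.ofList w))).val = θ w) ∧
      (∀ a b : (GCon n d μ).Quotient, (h (a * b)).val = θ ((h a).val ++ (h b).val))) := by
  have hcon : ∀ s, GCon n d μ (FreeMonoid.ofList s) (FreeMonoid.ofList (θ s)) :=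
    fun s => GCon_of_reflTransGen_GStep (hθ s).1
  have hNF : ∀ s, ∃ k e, θ s = NFword n d k e := fun s => exists_NFword_of_irreducible (hθ s).2
  have heval : ∀ s, evalWord μ (θ s) = evalWord μ s :=
    fun s => (evalWord_eq_of_GCon hskew hdiag (hcon s)).symm
  have hunique : ∀ {s t}, evalWord μ s = evalWord μ t → θ s = θ t := by
    intro s t hst
    rw [← heval s, ← heval t] at hst
    obtain ⟨k, e, hs⟩ := hNF s
    obtain ⟨k', e', ht⟩ := hNF t
    rw [hs, ht] at hst ⊢
    exact NFword_eq_of_evalWord_eq hst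
  have hfix : ∀ k e, θ (NFword n d k e) = NFword n d k e := by
    intro k e
    have h := heval (NFword n d k e)
    obtain ⟨k', e', hs⟩ := hNF (NFword n d k e)
    rw [hs] at h ⊢
    exact NFword_eq_of_evalWord_eq h
  refine ⟨fun u v => hNF _, fun u v w => hunique ?_, hfix, ?_⟩
  · simp only [evalWord_append, heval, mul_assoc]
  let f : (GCon n d μ).Quotient → {w : List (Letter n d) // ∃ k e, w = NFword n d k e} :=
    fun q => Con.liftOn q (fun w => ⟨θ (FreeMonoid.toList w), hNF _⟩)
      fun _ _ hab => Subtype.ext (hunique (evalWord_eq_of_GCon hskew hdiag hab))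
  have hf : Function.Bijective f := by
    constructor
    · intro a b
      induction a, b using Con.induction_on₂ with
      | H a b =>
        intro hab
        have h : θ (FreeMonoid.toList a) = θ (FreeMonoid.toList b) := congrArg Subtype.val hab
        refine (Con.eq _).2 ((GCon n d μ).trans (hcon (FreeMonoid.toList a)) ?_)
        rw [h]
        exact (GCon n d μ).symm (hcon (FreeMonoid.toList b))
    · rintro ⟨w, k, e, rfl⟩
      exact ⟨Con.mk' (GCon n d μ) (FreeMonoid.ofList (NFword n d k e)), Subtype.ext (hfix k e)⟩
  refine ⟨Equiv.ofBijective f hf, fun w => rfl, fun a b => ?_⟩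
  induction a, b using Con.induction_on₂ with
  | H a b =>
    change θ (FreeMonoid.toList a ++ FreeMonoid.toList b) =
      θ (θ (FreeMonoid.toList a) ++ θ (FreeMonoid.toList b))
    exact hunique (by simp only [evalWord_append, heval])
end

section
/- If there exists a contextual word for μ, then there is no non-contextual value assignment l : C(μ) → ℤ_d. -/
/-- `Σ𝒮(s)`: the sum over inversions of the word `s`. -/
def invSum (n d : ℕ) (μ : Fin n → Fin n → ZMod d) : List (Fin n) → ZMod d
  | [] => 0
  | x :: s => (s.map (fun y => if y < x then μ x y else 0)).sum + invSum n d μ s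

/-- `Σ𝒮(s,t)`: the sum over inversions between `s` and `t`. -/
def invSum2 (n d : ℕ) (μ : Fin n → Fin n → ZMod d) (s t : List (Fin n)) : ZMod d :=
  (s.map (fun x => (t.map (fun y => if y < x then μ x y else 0)).sum)).sum

/-- The formal commutator `⟦s,t⟧ := Σ𝒮(s,t) − Σ𝒮(t,s)`. -/
def fcomm (n d : ℕ) (μ : Fin n → Fin n → ZMod d) (s t : List (Fin n)) : ZMod d :=
  invSum2 n d μ s t - invSum2 n d μ t s

/-- Bracketings: binary trees with leaves labelled by generators. -/
inductive Brack (n : ℕ) : Type where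
  | leaf : Fin n → Brack n
  | node : Brack n → Brack n → Brack n

/-- `∂(β)`: the word of leaf labels of a bracketing. -/
def Brack.word {n : ℕ} : Brack n → List (Fin n)
  | .leaf x => [x]
  | .node b₁ b₂ => b₁.word ++ b₂.word

/-- A bracketing witnesses commuting products if `⟦∂(β₁), ∂(β₂)⟧ = 0` at every internal node. -/
def Brack.Ok (n d : ℕ) (μ : Fin n → Fin n → ZMod d) : Brack n → Prop
  | .leaf _ => True
  | .node b₁ b₂ =>
      fcomm n d μ b₁.word b₂.word = 0 ∧ Brack.Ok n d μ b₁ ∧ Brack.Ok n d μ b₂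

/-- `w` is formed out of commuting products. -/
def Commuting (n d : ℕ) (μ : Fin n → Fin n → ZMod d) (w : List (Fin n)) : Prop :=
  ∃ β : Brack n, Brack.Ok n d μ β ∧ β.word = w

/-- A contextual word for μ. -/
def ContextualWord (n d : ℕ) (μ : Fin n → Fin n → ZMod d) (w : List (Fin n)) : Prop :=
  w ≠ [] ∧ (∀ x : Fin n, d ∣ w.count x) ∧ Commuting n d μ w ∧ invSum n d μ w ≠ 0

/-- The strictly-lower-triangular pairing `μ̌(k⃗, l⃗) = k⃗ᵀ μ̌ l⃗`. -/
def cPair (n d : ℕ) (μ : Fin n → Fin n → ZMod d) (k l : Fin n → ZMod d) : ZMod d :=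
  ∑ i, ∑ j, if j < i then k i * μ i j * l j else 0

/-- The product of the group H(μ). -/
def Hmul (n d : ℕ) (μ : Fin n → Fin n → ZMod d)
    (g h : ZMod d × (Fin n → ZMod d)) : ZMod d × (Fin n → ZMod d) :=
  (g.1 + h.1 + cPair n d μ g.2 h.2, g.2 + h.2)

/-- C(μ): the smallest subset of H(μ) containing the scalars `(k, 0⃗)` and the
generators `(0, eᵢ)`, closed under products of commuting elements. -/
inductive InC (n d : ℕ) (μ : Fin n → Fin n → ZMod d) : ZMod d × (Fin n → ZMod d) → Prop where
  | scalar (k : ZMod d) : InC n d μ (k, 0)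
  | gen (i : Fin n) : InC n d μ (0, Pi.single i 1)
  | mul {g h : ZMod d × (Fin n → ZMod d)} : InC n d μ g → InC n d μ h →
      Hmul n d μ g h = Hmul n d μ h g → InC n d μ (Hmul n d μ g h)

/-- A non-contextual value assignment on C(μ). -/
def NCVA (n d : ℕ) (μ : Fin n → Fin n → ZMod d)
    (l : ZMod d × (Fin n → ZMod d) → ZMod d) : Prop :=
  (∀ k : ZMod d, l (k, 0) = k) ∧
  ∀ g h : ZMod d × (Fin n → ZMod d), InC n d μ g → InC n d μ h →
    Hmul n d μ g h = Hmul n d μ h g → l (Hmul n d μ g h) = l g + l h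

/-- The exponent vector of a word, counting each generator modulo `d`. -/
def countVec (n d : ℕ) (s : List (Fin n)) : Fin n → ZMod d :=
  fun i => (s.count i : ZMod d)

/-- The element of `H(μ)` obtained by multiplying out the letters of a word. -/
def wordElem (n d : ℕ) (μ : Fin n → Fin n → ZMod d) (s : List (Fin n)) :
    ZMod d × (Fin n → ZMod d) :=
  (invSum n d μ s, countVec n d s)

section

variable {n d : ℕ}

lemma countVec_append (s t : List (Fin n)) :
    countVec n d (s ++ t) = countVec n d s + countVec n d t := by
  funext i
  simp [countVec]

lemma countVec_nil : countVec n d [] = 0 := by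
  funext i
  simp [countVec]

lemma countVec_singleton (x : Fin n) : countVec n d [x] = Pi.single x 1 := by
  funext i
  by_cases h : i = x
  · subst h
    simp [countVec]
  · simp [countVec, h, Ne.symm h]

lemma countVec_cons (x : Fin n) (s : List (Fin n)) :
    countVec n d (x :: s) = Pi.single x 1 + countVec n d s := by
  rw [← countVec_singleton, ← countVec_append, List.singleton_append]

variable (μ : Fin n → Fin n → ZMod d)

lemma cPair_add_left (k k' l : Fin n → ZMod d) :
    cPair n d μ (k + k') l = cPair n d μ k l + cPair n d μ k' l := by
  simp only [cPair, ← Finset.sum_add_distrib]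
  refine Finset.sum_congr rfl fun i _ => Finset.sum_congr rfl fun j _ => ?_
  split_ifs
  · simp only [Pi.add_apply]
    ring
  · simp

lemma cPair_add_right (k l l' : Fin n → ZMod d) :
    cPair n d μ k (l + l') = cPair n d μ k l + cPair n d μ k l' := by
  simp only [cPair, ← Finset.sum_add_distrib]
  refine Finset.sum_congr rfl fun i _ => Finset.sum_congr rfl fun j _ => ?_
  split_ifs
  · simp only [Pi.add_apply]
    ring
  · simp

lemma cPair_zero_left (l : Fin n → ZMod d) : cPair n d μ 0 l = 0 := by
  simp [cPair]

lemma cPair_zero_right (k : Fin n → ZMod d) : cPair n d μ k 0 = 0 := by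
  simp [cPair]

lemma cPair_single_single (x y : Fin n) :
    cPair n d μ (Pi.single x 1) (Pi.single y 1) = if y < x then μ x y else 0 := by
  unfold cPair
  rw [Finset.sum_eq_single x, Finset.sum_eq_single y]
  · simp
  · intro j _ hj
    simp [hj]
  · simp
  · intro i _ hi
    simp [hi]
  · simp

lemma cPair_single_countVec (x : Fin n) (t : List (Fin n)) :
    cPair n d μ (Pi.single x 1) (countVec n d t) =
      (t.map (fun y => if y < x then μ x y else 0)).sum := by
  induction t with
  | nil => simp [countVec_nil, cPair_zero_right]
  | cons y t ih =>
    rw [countVec_cons, cPair_add_right, cPair_single_single, ih, List.map_cons, List.sum_cons]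

lemma cPair_countVec (s t : List (Fin n)) :
    cPair n d μ (countVec n d s) (countVec n d t) = invSum2 n d μ s t := by
  induction s with
  | nil => simp [countVec_nil, cPair_zero_left, invSum2]
  | cons x s ih =>
    rw [countVec_cons, cPair_add_left, cPair_single_countVec, ih]
    simp [invSum2]

lemma invSum_append (s t : List (Fin n)) :
    invSum n d μ (s ++ t) = invSum n d μ s + invSum n d μ t + invSum2 n d μ s t := by
  induction s with
  | nil => simp [invSum, invSum2]
  | cons x s ih =>
    rw [List.cons_append, invSum, invSum, ih]
    simp only [invSum2, List.map_append, List.sum_append, List.map_cons, List.sum_cons]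
    ring

lemma wordElem_append (s t : List (Fin n)) :
    wordElem n d μ (s ++ t) = Hmul n d μ (wordElem n d μ s) (wordElem n d μ t) := by
  simp only [wordElem, Hmul, invSum_append, countVec_append, cPair_countVec]

lemma wordElem_singleton (x : Fin n) : wordElem n d μ [x] = (0, Pi.single x 1) := by
  simp [wordElem, invSum, countVec_singleton]

lemma Hmul_wordElem_comm {s t : List (Fin n)} (h : fcomm n d μ s t = 0) :
    Hmul n d μ (wordElem n d μ s) (wordElem n d μ t) =
      Hmul n d μ (wordElem n d μ t) (wordElem n d μ s) := by
  simp only [wordElem, Hmul, cPair_countVec, sub_eq_zero.mp h]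
  ext1
  · simp only
    ring
  · exact add_comm _ _

lemma Brack.Ok.inC_wordElem {β : Brack n} (h : Brack.Ok n d μ β) :
    InC n d μ (wordElem n d μ β.word) := by
  induction β with
  | leaf x =>
    rw [Brack.word, wordElem_singleton]
    exact InC.gen x
  | node b₁ b₂ ih₁ ih₂ =>
    obtain ⟨hc, h₁, h₂⟩ := h
    rw [Brack.word, wordElem_append]
    exact InC.mul (ih₁ h₁) (ih₂ h₂) (Hmul_wordElem_comm μ hc)

lemma NCVA.apply_wordElem {l : ZMod d × (Fin n → ZMod d) → ZMod d} (hl : NCVA n d μ l)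
    {β : Brack n} (h : Brack.Ok n d μ β) :
    l (wordElem n d μ β.word) = (β.word.map fun x => l (0, Pi.single x 1)).sum := by
  induction β with
  | leaf x => simp [Brack.word, wordElem_singleton]
  | node b₁ b₂ ih₁ ih₂ =>
    obtain ⟨hc, h₁, h₂⟩ := h
    rw [Brack.word, wordElem_append, List.map_append, List.sum_append, ← ih₁ h₁, ← ih₂ h₂]
    exact hl.2 _ _ (h₁.inC_wordElem μ) (h₂.inC_wordElem μ) (Hmul_wordElem_comm μ hc)

lemma sum_map_eq_zero_of_dvd_count {w : List (Fin n)} (hw : ∀ x, d ∣ w.count x)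
    (f : Fin n → ZMod d) : (w.map f).sum = 0 := by
  rw [Finset.sum_list_map_count]
  refine Finset.sum_eq_zero fun x _ => ?_
  rw [nsmul_eq_mul, (ZMod.natCast_eq_zero_iff _ _).mpr (hw x), zero_mul]

end

theorem stmt6 (n d : ℕ) (hn : 1 ≤ n) (hd : 2 ≤ d) (μ : Fin n → Fin n → ZMod d)
    (hskew : ∀ i j, μ i j = - μ j i) (hdiag : ∀ i, μ i i = 0) :
    (∃ w : List (Fin n), ContextualWord n d μ w) →
    ¬ ∃ l : ZMod d × (Fin n → ZMod d) → ZMod d, NCVA n d μ l := by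
  rintro ⟨w, -, hcount, ⟨β, hβ, rfl⟩, hne⟩ ⟨l, hl⟩
  have hvec : countVec n d β.word = 0 :=
    funext fun x => (ZMod.natCast_eq_zero_iff _ _).mpr (hcount x)
  have hval := NCVA.apply_wordElem μ hl hβ
  rw [sum_map_eq_zero_of_dvd_count hcount, wordElem, hvec, hl.1] at hval
  exact hne hval
end
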